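/- Let n ≤ d, let A₀ ∈ Mat_{n,d}(ℝ) have non-negative entries, and let δ > 0. Then there exist matrices Q, K, V ∈ Mat_{n,d}(ℝ) such that ‖softmax(QKᵀ/√d) · V − A₀‖_F ≤ δ, where softmax is applied row-wise and ‖·‖_F denotes the Frobenius norm. -/

import Mathlib

open Matrix

/-- Row-wise softmax of a real matrix. -/
noncomputable def softmax {m n : ℕ} (M : Matrix (Fin m) (Fin n) ℝ) :
    Matrix (Fin m) (Fin n) ℝ :=
  fun i j => Real.exp (M i j) / ∑ k, Real.exp (M i k)

/-- Frobenius norm of a real matrix. -/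
noncomputable def frobNorm {m n : ℕ} (B : Matrix (Fin m) (Fin n) ℝ) : ℝ :=
  Real.sqrt (∑ i, ∑ j, (B i j) ^ 2)

/-- For `n ≤ d`, any non-negative matrix `A₀ ∈ Mat_{n,d}(ℝ)` and any
`δ > 0`, there exist `Q, K, V ∈ Mat_{n,d}(ℝ)` with
`‖softmax(QKᵀ/√d)·V − A₀‖_F ≤ δ`. -/
theorem attention_expressivity {n d : ℕ} (hnd : n ≤ d)
    (A₀ : Matrix (Fin n) (Fin d) ℝ) (hA₀ : ∀ i j, 0 ≤ A₀ i j)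
    (δ : ℝ) (hδ : 0 < δ) :
    ∃ Q K V : Matrix (Fin n) (Fin d) ℝ,
      frobNorm (softmax ((Real.sqrt d)⁻¹ • (Q * Kᵀ)) * V - A₀) ≤ δ := by
  let E : Matrix (Fin n) (Fin d) ℝ := fun i j => if Fin.castLE hnd i = j then 1 else 0
  have hE : E * Eᵀ = 1 := by
    ext i k
    rw [Matrix.mul_apply, Matrix.one_apply]
    simp only [Matrix.transpose_apply]
    simp only [E]
    simp [eq_comm]
  obtain ⟨V, hV⟩ : ∃ V : Matrix (Fin n) (Fin d) ℝ,
      ∀ i j, V i j = ((n : ℝ) + 1) * A₀ i j - ∑ k, A₀ k j := ⟨fun i j => _, fun i j => rfl⟩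
  refine ⟨(Real.sqrt d * Real.log 2) • E, E, V, ?_⟩
  have key : softmax ((Real.sqrt d)⁻¹ • (((Real.sqrt d * Real.log 2) • E) * Eᵀ)) *
      V = A₀ := by
    ext i j
    have hd : Real.sqrt d ≠ 0 := by
      have : 0 < d := Nat.lt_of_le_of_lt (Nat.zero_le _) j.isLt
      positivity
    have hn : (n : ℝ) + 1 ≠ 0 := by positivity
    have hexp : ∀ k, Real.exp (((Real.sqrt d)⁻¹ •
        (((Real.sqrt d * Real.log 2) • E) * Eᵀ)) i k) = 1 + (if i = k then 1 else 0) := by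
      intro k
      rw [Matrix.smul_mul, hE, smul_smul, inv_mul_cancel_left₀ hd]
      by_cases h : i = k
      · subst h
        simp [Real.exp_log]
        norm_num
      · simp [h]
    rw [Matrix.mul_apply]
    simp only [softmax, hexp, hV]
    have hs : ∑ k : Fin n, ((1 : ℝ) + (if i = k then 1 else 0)) = n + 1 := by
      simp [Finset.sum_add_distrib]
    rw [hs]
    have : ∀ k, (1 + (if i = k then (1 : ℝ) else 0)) / ((n : ℝ) + 1) *
        (((n : ℝ) + 1) * A₀ k j - ∑ l, A₀ l j) =
        (A₀ k j - (∑ l, A₀ l j) / ((n : ℝ) + 1)) +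
        (if i = k then (A₀ k j - (∑ l, A₀ l j) / ((n : ℝ) + 1)) else 0) := by
      intro k
      split_ifs <;> field_simp <;> ring
    rw [Finset.sum_congr rfl (fun k _ => this k)]
    rw [Finset.sum_add_distrib, Finset.sum_sub_distrib]
    simp
    field_simp
    ring
  rw [key]
  simp [frobNorm, hδ.le]
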